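/- arXiv:2509.19176 — 2 statements merged into one kernel-verified Lean document; each statement's English description precedes it below -/
import Mathlib

section
/- Let Σ₀ and Σ₁ be N×N positive definite real matrices, and for t ∈ [0,1] set Σ_t = (tΣ₁^{−1} + (1−t)Σ₀^{−1})^{−1}. Let X_t be a centered Gaussian random vector in ℝ^N with covariance matrix Σ_t, and let F: ℝ^N → ℝ be a smooth function which, together with all of its partial derivatives, grows at most polynomially at infinity. Then (d/dt) E[F(X_t)] = ½ Σ_{i,j=1}^N (dΣ_t/dt)(i,j) · E[(∂²F/∂x_i∂x_j)(X_t)]. -/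
open MeasureTheory Matrix

/-- Expectation of `F` under the centered Gaussian measure on `ℝ^N` with (positive
definite) covariance matrix `Sig`, whose density is proportional to
`exp(-½⟨x, Sig⁻¹ x⟩)`. -/
noncomputable def gaussExp (N : ℕ) (Sig : Matrix (Fin N) (Fin N) ℝ)
    (F : (Fin N → ℝ) → ℝ) : ℝ :=
  (∫ x : Fin N → ℝ, F x * Real.exp (-(1 / 2) * (x ⬝ᵥ (Sig⁻¹ *ᵥ x)))) /
    (∫ x : Fin N → ℝ, Real.exp (-(1 / 2) * (x ⬝ᵥ (Sig⁻¹ *ᵥ x))))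

/-- The partial derivative in the `i`-th coordinate. -/
noncomputable def pdC (N : ℕ) (i : Fin N) (F : (Fin N → ℝ) → ℝ) : (Fin N → ℝ) → ℝ :=
  fun x => deriv (fun u => F (Function.update x i u)) (x i)

open Filter Topology Function

lemma Matrix.PosDef.exists_mul_norm_sq_le {n : Type*} [Fintype n] {A : Matrix n n ℝ}
    (hA : A.PosDef) : ∃ c > 0, ∀ x : n → ℝ, c * ‖x‖ ^ 2 ≤ x ⬝ᵥ (A *ᵥ x) := by
  have hcont : Continuous fun x : n → ℝ => x ⬝ᵥ (A *ᵥ x) := by fun_prop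
  have hpos (x : n → ℝ) (hx : x ≠ 0) : 0 < x ⬝ᵥ (A *ᵥ x) := by
    simpa using hA.dotProduct_mulVec_pos hx
  obtain ⟨c, hc, h⟩ : ∃ c > 0, ∀ y ∈ Metric.sphere (0 : n → ℝ) 1, c ≤ y ⬝ᵥ (A *ᵥ y) :=
    (isCompact_sphere _ _).exists_forall_le' hcont.continuousOn (a := 0)
      fun y hy => hpos y (by rintro rfl; simp at hy)
  refine ⟨c, hc, fun x => ?_⟩
  rcases eq_or_ne x 0 with rfl | hx
  · simp
  have hn : 0 < ‖x‖ := norm_pos_iff.2 hx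
  have hy := h (‖x‖⁻¹ • x) (by simp [norm_smul, hn.ne'])
  rw [mulVec_smul, smul_dotProduct, dotProduct_smul, smul_eq_mul, smul_eq_mul, ← mul_assoc,
    ← mul_inv, inv_mul_eq_div, le_div_iff₀ (by positivity)] at hy
  rwa [pow_two]

lemma abs_dotProduct_mulVec_le {n : Type*} [Fintype n] (D : Matrix n n ℝ) (x : n → ℝ) :
    |x ⬝ᵥ (D *ᵥ x)| ≤ (∑ i, ∑ j, |D i j|) * ‖x‖ ^ 2 := by
  have hx (i : n) : |x i| ≤ ‖x‖ := norm_le_pi_norm x i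
  simp only [dotProduct, mulVec, Finset.mul_sum, Finset.sum_mul]
  refine (Finset.abs_sum_le_sum_abs _ _).trans (Finset.sum_le_sum fun i _ =>
    (Finset.abs_sum_le_sum_abs _ _).trans (Finset.sum_le_sum fun j _ => ?_))
  calc |x i * (D i j * x j)| = |D i j| * (|x i| * |x j|) := by rw [abs_mul, abs_mul]; ring
    _ ≤ |D i j| * ‖x‖ ^ 2 := by rw [pow_two]; gcongr <;> exact hx _

lemma Function.HasTemperateGrowth.fderiv {E F : Type*} [NormedAddCommGroup E] [NormedSpace ℝ E]
    [NormedAddCommGroup F] [NormedSpace ℝ F] {f : E → F} (hf : f.HasTemperateGrowth) :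
    (fderiv ℝ f).HasTemperateGrowth := by
  refine ⟨hf.1.fderiv_right (by simp), fun k => ?_⟩
  obtain ⟨m, C, h⟩ := hf.2 (k + 1)
  exact ⟨m, C, fun x => by rw [norm_iteratedFDeriv_fderiv]; exact h x⟩

section Integrability

variable {E : Type*} [NormedAddCommGroup E] [NormedSpace ℝ E] [FiniteDimensional ℝ E]
  [MeasurableSpace E] [BorelSpace E] (μ : Measure E) [μ.IsAddHaarMeasure]

lemma integrable_one_add_norm_pow_mul_exp_neg_mul_norm_sq {c : ℝ} (hc : 0 < c) (k : ℕ) :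
    Integrable (fun x : E => (1 + ‖x‖) ^ k * Real.exp (-c * ‖x‖ ^ 2)) μ := by
  set m := Module.finrank ℝ E + 1
  have hint : Integrable (fun x : E => (1 + ‖x‖) ^ (-(m : ℝ))) μ :=
    integrable_one_add_norm (by simp [m])
  refine (hint.const_mul (Real.exp (3 * c) * ((k + m).factorial / (2 * c) ^ (k + m)))).mono'
    (by fun_prop) (ae_of_all _ fun x => ?_)
  rw [Real.norm_of_nonneg (by positivity), Real.rpow_neg (by positivity), Real.rpow_natCast,
    ← div_eq_mul_inv, le_div_iff₀ (by positivity)]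
  set s := 1 + ‖x‖ with hs
  have hs0 : 0 < s := by positivity
  have h1 : Real.exp (-c * ‖x‖ ^ 2) ≤ Real.exp (3 * c) * Real.exp (-(2 * c * s)) := by
    rw [← Real.exp_add]
    apply Real.exp_le_exp.2
    nlinarith [mul_nonneg hc.le (sq_nonneg (‖x‖ - 1))]
  have h2 := Real.pow_div_factorial_le_exp (2 * c * s) (by positivity) (k + m)
  have h3 : s ^ (k + m) * Real.exp (-(2 * c * s)) ≤ (k + m).factorial / (2 * c) ^ (k + m) := by
    rw [le_div_iff₀ (by positivity), Real.exp_neg, ← div_eq_mul_inv, div_mul_eq_mul_div,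
      div_le_iff₀ (Real.exp_pos _), ← mul_pow, mul_comm s]
    rwa [div_le_iff₀' (by positivity)] at h2
  calc s ^ k * Real.exp (-c * ‖x‖ ^ 2) * s ^ m
      = s ^ (k + m) * Real.exp (-c * ‖x‖ ^ 2) := by ring
    _ ≤ s ^ (k + m) * (Real.exp (3 * c) * Real.exp (-(2 * c * s))) := by gcongr
    _ = Real.exp (3 * c) * (s ^ (k + m) * Real.exp (-(2 * c * s))) := by ring
    _ ≤ _ := by gcongr

variable {μ}

lemma Function.HasTemperateGrowth.integrable_mul_exp_neg_mul_norm_sq {G : E → ℝ}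
    (hG : G.HasTemperateGrowth) {c : ℝ} (hc : 0 < c) :
    Integrable (fun x => G x * Real.exp (-c * ‖x‖ ^ 2)) μ := by
  obtain ⟨k, C, h⟩ := hG.2 0
  have hGc : Continuous G := hG.1.continuous
  refine ((integrable_one_add_norm_pow_mul_exp_neg_mul_norm_sq μ hc k).const_mul C).mono'
    (Continuous.aestronglyMeasurable (by fun_prop)) (ae_of_all _ fun x => ?_)
  rw [norm_mul, Real.norm_of_nonneg (Real.exp_pos _).le, ← mul_assoc]
  gcongr
  simpa using h x

end Integrability

section GaussianWeight

variable {n : Type*} [Fintype n]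

/-- The unnormalised centered Gaussian density with precision matrix `A`. -/
noncomputable def gaussianWeight (A : Matrix n n ℝ) (x : n → ℝ) : ℝ :=
  Real.exp (-(1 / 2) * (x ⬝ᵥ (A *ᵥ x)))

lemma continuous_gaussianWeight (A : Matrix n n ℝ) : Continuous (gaussianWeight A) := by
  unfold gaussianWeight; fun_prop

lemma gaussianWeight_pos (A : Matrix n n ℝ) (x : n → ℝ) : 0 < gaussianWeight A x :=
  Real.exp_pos _

lemma gaussianWeight_le {A : Matrix n n ℝ} {c : ℝ} {x : n → ℝ}
    (h : c * ‖x‖ ^ 2 ≤ x ⬝ᵥ (A *ᵥ x)) :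
    gaussianWeight A x ≤ Real.exp (-(c / 2) * ‖x‖ ^ 2) :=
  Real.exp_le_exp.2 (by linarith)

lemma Function.HasTemperateGrowth.integrable_mul_gaussianWeight {A : Matrix n n ℝ} {c : ℝ}
    (hc : 0 < c) (hA : ∀ x : n → ℝ, c * ‖x‖ ^ 2 ≤ x ⬝ᵥ (A *ᵥ x))
    {G : (n → ℝ) → ℝ} (hG : G.HasTemperateGrowth) :
    Integrable (fun x => G x * gaussianWeight A x) := by
  refine (hG.integrable_mul_exp_neg_mul_norm_sq (half_pos hc)).mono
    (hG.1.continuous.mul (continuous_gaussianWeight A)).aestronglyMeasurable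
    (ae_of_all _ fun x => ?_)
  rw [norm_mul, norm_mul, Real.norm_of_nonneg (gaussianWeight_pos A x).le,
    Real.norm_of_nonneg (Real.exp_pos _).le]
  gcongr
  exact gaussianWeight_le (hA x)

lemma hasTemperateGrowth_mulVec_apply (A : Matrix n n ℝ) (i : n) :
    HasTemperateGrowth fun x : n → ℝ => (A *ᵥ x) i :=
  (LinearMap.toContinuousLinearMap ((LinearMap.proj i).comp A.mulVecLin)).hasTemperateGrowth

lemma hasFDerivAt_mulVec_apply (A : Matrix n n ℝ) (i : n) (x : n → ℝ) :
    HasFDerivAt (fun x : n → ℝ => (A *ᵥ x) i)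
      (LinearMap.toContinuousLinearMap ((LinearMap.proj i).comp A.mulVecLin)) x :=
  (LinearMap.toContinuousLinearMap ((LinearMap.proj i).comp A.mulVecLin)).hasFDerivAt

lemma hasTemperateGrowth_dotProduct_mulVec (D : Matrix n n ℝ) :
    HasTemperateGrowth fun x : n → ℝ => x ⬝ᵥ (D *ᵥ x) :=
  .sum fun i _ => (ContinuousLinearMap.proj (R := ℝ) (φ := fun _ : n => ℝ) i).hasTemperateGrowth.mul
    (hasTemperateGrowth_mulVec_apply D i)

lemma differentiable_gaussianWeight (A : Matrix n n ℝ) : Differentiable ℝ (gaussianWeight A) :=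
  (((hasTemperateGrowth_dotProduct_mulVec A).1.differentiable (by simp)).const_mul _).exp

lemma eventually_mul_norm_sq_le_add_smul {A : Matrix n n ℝ} {c : ℝ} (hc : 0 < c)
    (hA : ∀ x : n → ℝ, c * ‖x‖ ^ 2 ≤ x ⬝ᵥ (A *ᵥ x)) (D : Matrix n n ℝ) :
    ∀ᶠ u : ℝ in 𝓝 0, ∀ x : n → ℝ, c / 2 * ‖x‖ ^ 2 ≤ x ⬝ᵥ ((A + u • D) *ᵥ x) := by
  have hlim : Tendsto (fun u : ℝ => |u| * ∑ i, ∑ j, |D i j|) (𝓝 0) (𝓝 0) :=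
    Continuous.tendsto' (by fun_prop) _ _ (by simp)
  filter_upwards [hlim.eventually_lt_const (half_pos hc)] with u hu x
  have h1 : |u * (x ⬝ᵥ (D *ᵥ x))| ≤ c / 2 * ‖x‖ ^ 2 := by
    rw [abs_mul]
    calc |u| * |x ⬝ᵥ (D *ᵥ x)| ≤ |u| * ((∑ i, ∑ j, |D i j|) * ‖x‖ ^ 2) := by
          gcongr; exact abs_dotProduct_mulVec_le D x
      _ ≤ c / 2 * ‖x‖ ^ 2 := by rw [← mul_assoc]; gcongr
  rw [add_mulVec, smul_mulVec, dotProduct_add, dotProduct_smul, smul_eq_mul]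
  linarith [hA x, neg_abs_le (u * (x ⬝ᵥ (D *ᵥ x)))]

lemma hasDerivAt_integral_mul_gaussianWeight_add_smul {A : Matrix n n ℝ} {c : ℝ} (hc : 0 < c)
    (hA : ∀ x : n → ℝ, c * ‖x‖ ^ 2 ≤ x ⬝ᵥ (A *ᵥ x)) (D : Matrix n n ℝ)
    {G : (n → ℝ) → ℝ} (hG : G.HasTemperateGrowth) :
    HasDerivAt (fun u : ℝ => ∫ x, G x * gaussianWeight (A + u • D) x)
      (-(1 / 2) * ∫ x, G x * (x ⬝ᵥ (D *ᵥ x)) * gaussianWeight A x) 0 := by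
  have hGD := hG.mul (hasTemperateGrowth_dotProduct_mulVec D)
  have hGc : Continuous G := hG.1.continuous
  have hderiv (x : n → ℝ) (u : ℝ) : HasDerivAt (fun u : ℝ => G x * gaussianWeight (A + u • D) x)
      (-(1 / 2) * (G x * (x ⬝ᵥ (D *ᵥ x)) * gaussianWeight (A + u • D) x)) u := by
    have hq : HasDerivAt (fun u : ℝ => x ⬝ᵥ ((A + u • D) *ᵥ x)) (x ⬝ᵥ (D *ᵥ x)) u := by
      simp only [add_mulVec, smul_mulVec, dotProduct_add, dotProduct_smul, smul_eq_mul]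
      simpa using ((hasDerivAt_id u).mul_const (x ⬝ᵥ (D *ᵥ x))).const_add (x ⬝ᵥ (A *ᵥ x))
    refine ((hq.const_mul (-(1 / 2))).exp.const_mul (G x)).congr_deriv ?_
    simp only [gaussianWeight]
    ring
  have hmain := (hasDerivAt_integral_of_dominated_loc_of_deriv_le (μ := volume)
    (F := fun (u : ℝ) x => G x * gaussianWeight (A + u • D) x)
    (F' := fun (u : ℝ) x => -(1 / 2) * (G x * (x ⬝ᵥ (D *ᵥ x)) * gaussianWeight (A + u • D) x))
    (bound := fun x => 1 / 2 * ‖(G x * (x ⬝ᵥ (D *ᵥ x))) * Real.exp (-(c / 2 / 2) * ‖x‖ ^ 2)‖)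
    (eventually_mul_norm_sq_le_add_smul hc hA D)
    (Eventually.of_forall fun u =>
      (hGc.mul (continuous_gaussianWeight _)).aestronglyMeasurable)
    (by simpa using hG.integrable_mul_gaussianWeight hc hA)
    (continuous_const.mul
      (hGD.1.continuous.mul (continuous_gaussianWeight _))).aestronglyMeasurable
    (ae_of_all _ fun x u hu => ?_)
    ((hGD.integrable_mul_exp_neg_mul_norm_sq (by positivity)).norm.const_mul _)
    (ae_of_all _ fun x u _ => hderiv x u)).2
  · simpa only [integral_const_mul, zero_smul, add_zero] using hmain
  · simp only [norm_mul, norm_neg]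
    rw [Real.norm_of_nonneg (gaussianWeight_pos _ x).le, Real.norm_of_nonneg (Real.exp_pos _).le,
      Real.norm_of_nonneg (by norm_num : (0 : ℝ) ≤ 1 / 2)]
    gcongr
    exact gaussianWeight_le (hu x)

lemma integral_gaussianWeight_pos {A : Matrix n n ℝ} {c : ℝ} (hc : 0 < c)
    (hA : ∀ x : n → ℝ, c * ‖x‖ ^ 2 ≤ x ⬝ᵥ (A *ᵥ x)) : 0 < ∫ x, gaussianWeight A x :=
  integral_exp_pos (by
    simpa [gaussianWeight] using
      (HasTemperateGrowth.const (E := n → ℝ) (1 : ℝ)).integrable_mul_gaussianWeight hc hA)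

variable [DecidableEq n]

lemma fderiv_gaussianWeight_single {A : Matrix n n ℝ} (hA : A.IsSymm) (x : n → ℝ) (i : n) :
    fderiv ℝ (gaussianWeight A) x (Pi.single i 1) = -((A *ᵥ x) i * gaussianWeight A x) := by
  have hq : HasDerivAt (fun s : ℝ => (x + s • Pi.single i 1) ⬝ᵥ (A *ᵥ (x + s • Pi.single i 1)))
      (2 * (A *ᵥ x) i) 0 := by
    have hexp : (fun s : ℝ => (x + s • Pi.single i 1) ⬝ᵥ (A *ᵥ (x + s • Pi.single i 1))) =
        fun s => x ⬝ᵥ (A *ᵥ x) + s * (2 * (A *ᵥ x) i) + s ^ 2 * A i i := by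
      ext s
      have hsym : x ⬝ᵥ (A *ᵥ Pi.single i 1) = (A *ᵥ x) i := by
        rw [dotProduct_mulVec, ← mulVec_transpose, hA.eq, dotProduct_single_one]
      simp only [mulVec_add, mulVec_smul, add_dotProduct, dotProduct_add, smul_dotProduct,
        dotProduct_smul, hsym, single_one_dotProduct, smul_eq_mul]
      simp
      ring
    rw [hexp]
    have := (((hasDerivAt_id (0 : ℝ)).mul_const (2 * (A *ᵥ x) i)).const_add
      (x ⬝ᵥ (A *ᵥ x))).add (((hasDerivAt_id (0 : ℝ)).pow 2).mul_const (A i i))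
    simpa using! this
  rw [← (differentiable_gaussianWeight A x).lineDeriv_eq_fderiv]
  refine HasDerivAt.deriv ((hq.const_mul (-(1 / 2))).exp.congr_deriv ?_)
  simp only [gaussianWeight, zero_smul, add_zero]
  ring

lemma integral_fderiv_single_mul_gaussianWeight {A : Matrix n n ℝ} (hsymm : A.IsSymm) {c : ℝ}
    (hc : 0 < c) (hA : ∀ x : n → ℝ, c * ‖x‖ ^ 2 ≤ x ⬝ᵥ (A *ᵥ x))
    {G : (n → ℝ) → ℝ} (hG : G.HasTemperateGrowth) (i : n) :
    ∫ x, fderiv ℝ G x (Pi.single i 1) * gaussianWeight A x =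
      ∫ x, G x * (A *ᵥ x) i * gaussianWeight A x := by
  have hG' : HasTemperateGrowth fun x => fderiv ℝ G x (Pi.single i 1) :=
    (ContinuousLinearMap.apply ℝ ℝ (Pi.single i 1 : n → ℝ)).hasTemperateGrowth.comp hG.fderiv
  have hparts := integral_mul_fderiv_eq_neg_fderiv_mul_of_integrable (μ := volume)
    (f := G) (g := gaussianWeight A) (v := Pi.single i 1)
    (hG'.integrable_mul_gaussianWeight hc hA)
    (by
      simp only [fderiv_gaussianWeight_single hsymm, mul_neg, ← mul_assoc]
      exact ((hG.mul (hasTemperateGrowth_mulVec_apply A i)).integrable_mul_gaussianWeight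
        hc hA).neg)
    (hG.integrable_mul_gaussianWeight hc hA)
    (fun x _ => (hG.1.differentiable (by simp)) x)
    (fun x _ => differentiable_gaussianWeight A x)
  simp only [fderiv_gaussianWeight_single hsymm, mul_neg, ← mul_assoc, integral_neg,
    neg_inj] at hparts
  exact hparts.symm

lemma integral_fderiv_fderiv_single_mul_gaussianWeight {A : Matrix n n ℝ} (hsymm : A.IsSymm)
    {c : ℝ} (hc : 0 < c) (hA : ∀ x : n → ℝ, c * ‖x‖ ^ 2 ≤ x ⬝ᵥ (A *ᵥ x))
    {F : (n → ℝ) → ℝ} (hF : F.HasTemperateGrowth) (i j : n) :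
    ∫ x, fderiv ℝ (fun y => fderiv ℝ F y (Pi.single j 1)) x (Pi.single i 1) * gaussianWeight A x =
      (∫ x, F x * (A *ᵥ x) i * (A *ᵥ x) j * gaussianWeight A x) -
        A i j * ∫ x, F x * gaussianWeight A x := by
  have hF' : HasTemperateGrowth fun x => fderiv ℝ F x (Pi.single j 1) :=
    (ContinuousLinearMap.apply ℝ ℝ (Pi.single j 1 : n → ℝ)).hasTemperateGrowth.comp hF.fderiv
  have hl := hasTemperateGrowth_mulVec_apply A i
  have h2 := integral_fderiv_single_mul_gaussianWeight hsymm hc hA (hF.mul hl) j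
  have hd (x : n → ℝ) : fderiv ℝ (F * fun x => (A *ᵥ x) i) x (Pi.single j 1) =
      fderiv ℝ F x (Pi.single j 1) * (A *ᵥ x) i + A i j * F x := by
    rw [((hF.1.differentiable (by simp) x).hasFDerivAt.mul (hasFDerivAt_mulVec_apply A i x)).fderiv]
    simp
    ring
  have hint : Integrable fun x =>
      fderiv ℝ F x (Pi.single j 1) * (A *ᵥ x) i * gaussianWeight A x :=
    (hF'.mul hl).integrable_mul_gaussianWeight hc hA
  simp only [hd, add_mul, mul_assoc (A i j)] at h2
  rw [integral_add hint ((hF.integrable_mul_gaussianWeight hc hA).const_mul _),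
    integral_const_mul] at h2
  rw [integral_fderiv_single_mul_gaussianWeight hsymm hc hA hF' i]
  exact eq_sub_of_add_eq h2

lemma sum_mul_integral_fderiv_fderiv_mul_gaussianWeight {A : Matrix n n ℝ} (hsymm : A.IsSymm)
    {c : ℝ} (hc : 0 < c) (hA : ∀ x : n → ℝ, c * ‖x‖ ^ 2 ≤ x ⬝ᵥ (A *ᵥ x))
    {F : (n → ℝ) → ℝ} (hF : F.HasTemperateGrowth) (S : Matrix n n ℝ) :
    ∑ i, ∑ j, S i j *
      ∫ x, fderiv ℝ (fun y => fderiv ℝ F y (Pi.single j 1)) x (Pi.single i 1) *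
        gaussianWeight A x =
      (∫ x, F x * (x ⬝ᵥ ((A * S * A) *ᵥ x)) * gaussianWeight A x) -
        (∑ i, ∑ j, S i j * A i j) * ∫ x, F x * gaussianWeight A x := by
  have hint (i j : n) : Integrable fun x =>
      S i j * (F x * (A *ᵥ x) i * (A *ᵥ x) j * gaussianWeight A x) :=
    (((hF.mul (hasTemperateGrowth_mulVec_apply A i)).mul
      (hasTemperateGrowth_mulVec_apply A j)).integrable_mul_gaussianWeight hc hA).const_mul _
  have hquad (x : n → ℝ) : x ⬝ᵥ ((A * S * A) *ᵥ x) =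
      ∑ i, ∑ j, S i j * ((A *ᵥ x) i * (A *ᵥ x) j) := by
    rw [← mulVec_mulVec, ← mulVec_mulVec, dotProduct_mulVec, ← mulVec_transpose, hsymm.eq]
    generalize A *ᵥ x = y
    simp only [dotProduct, mulVec, Finset.mul_sum]
    exact Finset.sum_congr rfl fun i _ => Finset.sum_congr rfl fun j _ => by ring
  have hsum : ∫ x, F x * (x ⬝ᵥ ((A * S * A) *ᵥ x)) * gaussianWeight A x =
      ∑ i, ∑ j, S i j * ∫ x, F x * (A *ᵥ x) i * (A *ᵥ x) j * gaussianWeight A x := by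
    simp only [← integral_const_mul]
    simp_rw [← integral_finsetSum _ fun j _ => hint _ j]
    rw [← integral_finsetSum _ fun i _ => integrable_finsetSum _ fun j _ => hint i j]
    congr 1 with x
    simp only [hquad, Finset.mul_sum, Finset.sum_mul]
    exact Finset.sum_congr rfl fun i _ => Finset.sum_congr rfl fun j _ => by ring
  rw [hsum]
  simp only [integral_fderiv_fderiv_single_mul_gaussianWeight hsymm hc hA hF, mul_sub,
    Finset.sum_sub_distrib, Finset.sum_mul, mul_assoc]

end GaussianWeight

open scoped Matrix.Norms.Operator in
lemma Matrix.hasDerivAt_inv_add_smul_apply {n : Type*} [Fintype n] [DecidableEq n]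
    {A : Matrix n n ℝ} (hA : IsUnit A) (D : Matrix n n ℝ) (i j : n) :
    HasDerivAt (fun u : ℝ => (A + u • D)⁻¹ i j) (-(A⁻¹ * D * A⁻¹) i j) 0 := by
  obtain ⟨a, rfl⟩ := hA
  have hline : HasDerivAt (fun u : ℝ => (a : Matrix n n ℝ) + u • D) D 0 :=
    (((hasDerivAt_id (0 : ℝ)).smul_const D).const_add (a : Matrix n n ℝ)).congr_deriv
      (one_smul ℝ D)
  have hinv : HasFDerivAt Ring.inverse
      (-ContinuousLinearMap.mulLeftRight ℝ (Matrix n n ℝ) ↑a⁻¹ ↑a⁻¹)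
      ((a : Matrix n n ℝ) + (0 : ℝ) • D) := by
    simpa using hasFDerivAt_ringInverse (𝕜 := ℝ) a
  have h := hinv.comp_hasDerivAt (0 : ℝ) hline
  have hij := (hasDerivAt_pi.1 ((hasDerivAt_pi.1 h) i)) j
  simp only [nonsing_inv_eq_ringInverse, Ring.inverse_unit]
  exact hij

lemma pdC_eq_fderiv {N : ℕ} {F : (Fin N → ℝ) → ℝ} (hF : Differentiable ℝ F) (i : Fin N) :
    pdC N i F = fun x => fderiv ℝ F x (Pi.single i 1) := by
  ext x
  have h : HasFDerivAt F (fderiv ℝ F x) (update x i (x i)) := by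
    simpa using (hF x).hasFDerivAt
  exact (h.comp_hasDerivAt (x i) (hasDerivAt_update x i (x i))).deriv

lemma gaussExp_inv {N : ℕ} {A : Matrix (Fin N) (Fin N) ℝ} (hA : IsUnit A.det)
    (F : (Fin N → ℝ) → ℝ) :
    gaussExp N A⁻¹ F = (∫ x, F x * gaussianWeight A x) / ∫ x, gaussianWeight A x := by
  simp only [gaussExp, gaussianWeight, nonsing_inv_nonsing_inv A hA]

lemma hasDerivAt_gaussExp_inv_add_smul {N : ℕ} {A D : Matrix (Fin N) (Fin N) ℝ} (hA : A.PosDef)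
    {F : (Fin N → ℝ) → ℝ} (hF : F.HasTemperateGrowth) :
    HasDerivAt (fun u : ℝ => gaussExp N (A + u • D)⁻¹ F)
      ((1 / 2) * ∑ i, ∑ j, -(A⁻¹ * D * A⁻¹) i j * gaussExp N A⁻¹ (pdC N i (pdC N j F))) 0 := by
  obtain ⟨c, hc, hcA⟩ := hA.exists_mul_norm_sq_le
  have hsymm : A.IsSymm := by simpa [IsHermitian, IsSymm] using hA.isHermitian
  have hdet : IsUnit A.det := hA.det_pos.ne'.isUnit
  have hone : HasTemperateGrowth fun _ : Fin N → ℝ => (1 : ℝ) := .const 1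
  have hZ := integral_gaussianWeight_pos hc hcA
  have hconj : A * (A⁻¹ * D * A⁻¹) * A = D := by
    rw [Matrix.mul_assoc A⁻¹, mul_nonsing_inv_cancel_left _ _ hdet,
      nonsing_inv_mul_cancel_right _ _ hdet]
  have hsumF := sum_mul_integral_fderiv_fderiv_mul_gaussianWeight hsymm hc hcA hF (A⁻¹ * D * A⁻¹)
  have hsum1 := sum_mul_integral_fderiv_fderiv_mul_gaussianWeight hsymm hc hcA hone
    (A⁻¹ * D * A⁻¹)
  have hN := hasDerivAt_integral_mul_gaussianWeight_add_smul hc hcA D hF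
  have hD := hasDerivAt_integral_mul_gaussianWeight_add_smul hc hcA D hone
  have hpd (i j : Fin N) : pdC N i (pdC N j F) = fun x =>
      fderiv ℝ (fun y => fderiv ℝ F y (Pi.single j 1)) x (Pi.single i 1) := by
    have hF' : HasTemperateGrowth fun x => fderiv ℝ F x (Pi.single j 1) :=
      (ContinuousLinearMap.apply ℝ ℝ (Pi.single j 1 : Fin N → ℝ)).hasTemperateGrowth.comp hF.fderiv
    rw [pdC_eq_fderiv (hF.1.differentiable (by simp)),
      pdC_eq_fderiv (hF'.1.differentiable (by simp))]
  rw [hconj] at hsumF hsum1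
  simp only [one_mul, fderiv_fun_const, Pi.zero_apply, _root_.zero_apply, zero_mul,
    integral_zero, mul_zero, Finset.sum_const_zero] at hsum1 hD
  have hev : ∀ᶠ u : ℝ in 𝓝 0, gaussExp N (A + u • D)⁻¹ F =
      (∫ x, F x * gaussianWeight (A + u • D) x) / ∫ x, gaussianWeight (A + u • D) x := by
    have hcont : Continuous fun u : ℝ => (A + u • D).det := by fun_prop
    filter_upwards [hcont.continuousAt.eventually_ne (x := 0) (y := 0)
      (by simpa using hdet.ne_zero)] with u hu
    exact gaussExp_inv hu.isUnit F
  refine HasDerivAt.congr_of_eventuallyEq ?_ hev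
  refine (hN.div hD (by simpa using hZ.ne')).congr_deriv ?_
  have hrhs : ∑ i, ∑ j, -(A⁻¹ * D * A⁻¹) i j * gaussExp N A⁻¹ (pdC N i (pdC N j F)) =
      -((∑ i, ∑ j, (A⁻¹ * D * A⁻¹) i j *
        ∫ x, fderiv ℝ (fun y => fderiv ℝ F y (Pi.single j 1)) x (Pi.single i 1) *
          gaussianWeight A x) / ∫ x, gaussianWeight A x) := by
    simp only [hpd, gaussExp_inv hdet, Finset.sum_div, ← Finset.sum_neg_distrib, neg_mul,
      mul_div_assoc]
  rw [hrhs, hsumF]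
  simp only [zero_smul, add_zero]
  rw [sub_eq_zero.1 hsum1.symm]
  field_simp
  ring

/-- **Lemma (derivative of a Gaussian expectation along an interpolation of
covariances).**  With `Σ_t = (tΣ₁⁻¹ + (1-t)Σ₀⁻¹)⁻¹` and `X_t` centered Gaussian with
covariance `Σ_t`, for smooth `F` with all derivatives of at most polynomial growth,
`(d/dt) E[F(X_t)] = ½ Σ_{i,j} (dΣ_t/dt)(i,j) E[∂²F/∂x_i∂x_j (X_t)]`. -/
theorem gaussian_interpolation_derivative
    (N : ℕ) (Sig0 Sig1 : Matrix (Fin N) (Fin N) ℝ) (h0 : Sig0.PosDef) (h1 : Sig1.PosDef)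
    (F : (Fin N → ℝ) → ℝ) (hF : ContDiff ℝ (⊤ : ℕ∞) F)
    (hgrow : ∀ k : ℕ, ∃ C : ℝ, ∃ q : ℕ, ∀ x : Fin N → ℝ,
      ‖iteratedFDeriv ℝ k F x‖ ≤ C * (1 + ‖x‖) ^ q)
    (Sigt : ℝ → Matrix (Fin N) (Fin N) ℝ)
    (hSigt : ∀ t : ℝ, Sigt t = (t • Sig1⁻¹ + (1 - t) • Sig0⁻¹)⁻¹)
    (t : ℝ) (ht : t ∈ Set.Icc (0:ℝ) 1) :
    HasDerivAt (fun u => gaussExp N (Sigt u) F)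
      ((1 / 2) * ∑ i, ∑ j,
        deriv (fun u => Sigt u i j) t * gaussExp N (Sigt t) (pdC N i (pdC N j F))) t := by
  obtain rfl : Sigt = fun u => (u • Sig1⁻¹ + (1 - u) • Sig0⁻¹)⁻¹ := funext hSigt
  have hA : (t • Sig1⁻¹ + (1 - t) • Sig0⁻¹).PosDef := by
    rcases ht.1.eq_or_lt with rfl | h
    · simpa using h0.inv
    · exact (h1.inv.smul h).add_posSemidef (h0.inv.posSemidef.smul (sub_nonneg.2 ht.2))
  have hline (u : ℝ) : u • Sig1⁻¹ + (1 - u) • Sig0⁻¹ =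
      (t • Sig1⁻¹ + (1 - t) • Sig0⁻¹) + (u - t) • (Sig1⁻¹ - Sig0⁻¹) := by
    module
  have hFt : F.HasTemperateGrowth :=
    ⟨hF, fun k => let ⟨C, q, h⟩ := hgrow k; ⟨q, C, h⟩⟩
  set A := t • Sig1⁻¹ + (1 - t) • Sig0⁻¹
  set D := Sig1⁻¹ - Sig0⁻¹
  have hderiv (i j : Fin N) :
      deriv (fun u : ℝ => (u • Sig1⁻¹ + (1 - u) • Sig0⁻¹)⁻¹ i j) t = -(A⁻¹ * D * A⁻¹) i j := by
    simp only [hline]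
    exact (HasDerivAt.comp_sub_const t t (f := fun u : ℝ => (A + u • D)⁻¹ i j)
      (by simpa using hasDerivAt_inv_add_smul_apply hA.isUnit D i j)).deriv
  simp only [hderiv]
  simp only [hline]
  simpa using HasDerivAt.comp_sub_const t t (f := fun u : ℝ => gaussExp N (A + u • D)⁻¹ F)
    (by simpa using hasDerivAt_gaussExp_inv_add_smul (D := D) hA hFt)
end

section
/- There exists a C^∞ function χ: ℝ → [0,1] such that: (1) χ(t) = χ(−t) for all t ∈ ℝ; (2) χ(t) = 1 for |t| ≤ 1 and χ(t) = 0 for |t| ≥ 2; and (3) there is a constant C > 0 such that for all k ≥ 1, sup_{t∈ℝ} |χ^{(k)}(t)| ≤ C (k!)². -/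
open Set Filter Topology
open scoped Nat

/-- `f` is smooth and its `k`-th derivative is uniformly `O(A ^ k * (k !) ^ 2)`. -/
def IsGevreyTwo (A : ℝ) (f : ℝ → ℝ) : Prop :=
  ContDiff ℝ (⊤ : ℕ∞) f ∧
    ∃ C : ℝ, ∀ (k : ℕ) (x : ℝ), |iteratedDeriv k f x| ≤ C * (A ^ k * (k ! : ℝ) ^ 2)

namespace IsGevreyTwo

variable {A : ℝ} {f g : ℝ → ℝ}

theorem contDiff_nat (hf : IsGevreyTwo A f) (n : ℕ) : ContDiff ℝ n f :=
  hf.1.of_le (mod_cast le_top)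

theorem comp_affine (hf : IsGevreyTwo A f) (a b : ℝ) :
    IsGevreyTwo (|a| * A) (fun x => f (a * x + b)) := by
  obtain ⟨hc, C, hC⟩ := hf
  have hc' : ContDiff ℝ (⊤ : ℕ∞) (fun x => f (x + b)) := hc.comp (by fun_prop)
  refine ⟨hc.comp (by fun_prop), C, fun k x => ?_⟩
  have h1 := congrFun (iteratedDeriv_comp_const_mul (n := k) (hc'.of_le (mod_cast le_top)) a) x
  simp only [iteratedDeriv_comp_add_const] at h1
  rw [h1, abs_mul, abs_pow, mul_pow]
  calc |a| ^ k * |iteratedDeriv k f (a * x + b)|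
      ≤ |a| ^ k * (C * (A ^ k * (k ! : ℝ) ^ 2)) := by gcongr; exact hC _ _
    _ = _ := by ring

theorem mul (hA : 0 ≤ A) (hf : IsGevreyTwo A f) (hg : IsGevreyTwo A g) :
    IsGevreyTwo (2 * A) (f * g) := by
  have hfn := hf.contDiff_nat
  have hgn := hg.contDiff_nat
  obtain ⟨hcf, C, hC⟩ := hf
  obtain ⟨hcg, D, hD⟩ := hg
  have hC0 : 0 ≤ C := by simpa using (abs_nonneg _).trans (hC 0 0)
  have hD0 : 0 ≤ D := by simpa using (abs_nonneg _).trans (hD 0 0)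
  refine ⟨hcf.mul hcg, C * D, fun k x => ?_⟩
  rw [iteratedDeriv_mul (hfn k).contDiffAt (hgn k).contDiffAt]
  have key : ∀ i ∈ Finset.range (k + 1),
      |(k.choose i : ℝ) * iteratedDeriv i f x * iteratedDeriv (k - i) g x| ≤
        C * D * (A ^ k * (k ! : ℝ) ^ 2) := by
    intro i hi
    have hik : i ≤ k := by grind
    have h1 : (k.choose i : ℝ) * i ! * (k - i)! = k ! :=
      mod_cast Nat.choose_mul_factorial_mul_factorial hik
    have h2 : (i ! : ℝ) * (k - i)! ≤ k ! :=
      mod_cast Nat.le_of_dvd (Nat.factorial_pos k) (Nat.factorial_mul_factorial_dvd_factorial hik)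
    have h3 : A ^ i * A ^ (k - i) = A ^ k := by rw [← pow_add, Nat.add_sub_cancel' hik]
    rw [abs_mul, abs_mul, Nat.abs_cast]
    calc (k.choose i : ℝ) * |iteratedDeriv i f x| * |iteratedDeriv (k - i) g x|
        ≤ k.choose i * (C * (A ^ i * (i ! : ℝ) ^ 2)) *
            (D * (A ^ (k - i) * ((k - i)! : ℝ) ^ 2)) := by
          gcongr
          · exact hC _ _
          · exact hD _ _
      _ = C * D * (A ^ i * A ^ (k - i)) * ((k.choose i * i ! * (k - i)!) * (i ! * (k - i)!)) := by
          ring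
      _ ≤ C * D * A ^ k * (k ! * k !) := by rw [h1, h3]; gcongr
      _ = _ := by ring
  have h2k : ((k + 1 : ℕ) : ℝ) ≤ 2 ^ k := mod_cast Nat.lt_two_pow_self
  calc _ ≤ ∑ i ∈ Finset.range (k + 1), C * D * (A ^ k * (k ! : ℝ) ^ 2) :=
        (Finset.abs_sum_le_sum_abs _ _).trans (Finset.sum_le_sum key)
    _ = (k + 1 : ℕ) * (C * D * (A ^ k * (k ! : ℝ) ^ 2)) := by simp
    _ ≤ 2 ^ k * (C * D * (A ^ k * (k ! : ℝ) ^ 2)) := by gcongr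
    _ = _ := by rw [mul_pow]; ring

theorem const_mul (c : ℝ) (hf : IsGevreyTwo A f) : IsGevreyTwo A (fun x => c * f x) := by
  obtain ⟨hc, C, hC⟩ := hf
  refine ⟨contDiff_const.mul hc, |c| * C, fun k x => ?_⟩
  rw [iteratedDeriv_const_mul_field, abs_mul, mul_assoc]
  gcongr
  exact hC _ _

theorem of_deriv (hA : 0 < A) (hf : Differentiable ℝ f) {B : ℝ} (hB : ∀ x, |f x| ≤ B)
    (h : IsGevreyTwo A (deriv f)) : IsGevreyTwo A f := by
  obtain ⟨hc, C, hC⟩ := h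
  have hC0 : 0 ≤ C := by simpa using (abs_nonneg _).trans (hC 0 0)
  refine ⟨contDiff_infty_iff_deriv.2 ⟨hf, hc⟩, max B (C / A), fun k x => ?_⟩
  cases k with
  | zero => simpa using Or.inl (hB x)
  | succ k =>
    rw [iteratedDeriv_succ']
    calc |iteratedDeriv k (deriv f) x| ≤ C * (A ^ k * (k ! : ℝ) ^ 2) := hC k x
      _ = C / A * (A ^ (k + 1) * (k ! : ℝ) ^ 2) := by field_simp; ring
      _ ≤ max B (C / A) * (A ^ (k + 1) * ((k + 1)! : ℝ) ^ 2) := by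
        have : (0 : ℝ) ≤ C / A := by positivity
        have : (k ! : ℝ) ≤ (k + 1)! := mod_cast Nat.factorial_le (Nat.le_succ k)
        gcongr
        exact le_max_right _ _

end IsGevreyTwo

theorem iteratedDeriv_expNegInvGlue_of_pos (k : ℕ) {x : ℝ} (hx : 0 < x) :
    iteratedDeriv k expNegInvGlue x =
      (iteratedDeriv k (fun z : ℂ => Complex.exp (-z⁻¹)) (x : ℂ)).re := by
  induction k generalizing x with
  | zero =>
    simp only [iteratedDeriv_zero, expNegInvGlue, not_le.2 hx, if_false]
    rw [← Complex.ofReal_inv, ← Complex.ofReal_neg, Complex.exp_ofReal_re]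
  | succ k ih =>
    have hx' : (x : ℂ) ≠ 0 := by exact_mod_cast hx.ne'
    have ha : AnalyticAt ℂ (fun z : ℂ => Complex.exp (-z⁻¹)) x := by fun_prop (disch := assumption)
    have hd := ((ha.iterated_deriv k).differentiableAt.hasDerivAt).real_of_complex
    rw [iteratedDeriv_succ, iteratedDeriv_succ, iteratedDeriv_eq_iterate (n := k) (𝕜 := ℂ),
      ← hd.deriv]
    refine EventuallyEq.deriv_eq ?_
    filter_upwards [lt_mem_nhds hx] with y hy
    rw [ih hy, iteratedDeriv_eq_iterate]

theorem norm_cexp_neg_inv_le {x : ℝ} (hx : 0 < x) {z : ℂ}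
    (hz : z ∈ Metric.sphere (x : ℂ) (x / 2)) :
    ‖Complex.exp (-z⁻¹)‖ ≤ Real.exp (-(2 / (9 * x))) := by
  rw [mem_sphere_iff_norm] at hz
  have hre : x / 2 ≤ z.re := by
    have := (abs_le.1 ((Complex.abs_re_le_norm (z - x)).trans hz.le)).1
    simp at this
    linarith
  have hn : ‖z‖ ≤ 3 * x / 2 := by
    have := norm_add_le (z - x) (x : ℂ)
    rw [hz, sub_add_cancel, Complex.norm_real, Real.norm_eq_abs, abs_of_pos hx] at this
    linarith
  have hz0 : 0 < ‖z‖ := by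
    have := Complex.re_le_norm z
    linarith
  rw [Complex.norm_exp, Complex.neg_re, Complex.inv_re, Complex.normSq_eq_norm_sq]
  refine Real.exp_le_exp.2 (neg_le_neg ?_)
  calc 2 / (9 * x) = (x / 2) / (3 * x / 2) ^ 2 := by field_simp; norm_num
    _ ≤ z.re / ‖z‖ ^ 2 := by
      have : 0 ≤ z.re := by linarith
      gcongr

theorem abs_iteratedDeriv_expNegInvGlue_le_of_pos (k : ℕ) {x : ℝ} (hx : 0 < x) :
    |iteratedDeriv k expNegInvGlue x| ≤ 9 ^ k * (k ! : ℝ) ^ 2 := by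
  have hdiff : DiffContOnCl ℂ (fun z : ℂ => Complex.exp (-z⁻¹)) (Metric.ball (x : ℂ) (x / 2)) := by
    refine DifferentiableOn.diffContOnCl fun z hz => ?_
    have hz0 : z ≠ 0 := by
      rintro rfl
      have := Metric.closure_ball_subset_closedBall hz
      rw [Metric.mem_closedBall, dist_comm, dist_zero_right, Complex.norm_real, Real.norm_eq_abs,
        abs_of_pos hx] at this
      linarith
    exact ((differentiableAt_inv hz0).neg.cexp).differentiableWithinAt
  rw [iteratedDeriv_expNegInvGlue_of_pos k hx]
  refine (Complex.abs_re_le_norm _).trans ?_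
  refine (Complex.norm_iteratedDeriv_le_of_forall_mem_sphere_norm_le k (half_pos hx) hdiff
    fun z hz => norm_cexp_neg_inv_le hx hz).trans ?_
  have hy : 0 ≤ 2 / (9 * x) := by positivity
  have hpow := Real.pow_div_factorial_le_exp _ hy k
  rw [div_le_iff₀ (by positivity)] at hpow
  calc (k ! : ℝ) * Real.exp (-(2 / (9 * x))) / (x / 2) ^ k
      = 9 ^ k * k ! * (Real.exp (-(2 / (9 * x))) * (2 / (9 * x)) ^ k) := by
        rw [div_pow, div_pow, mul_pow]; field_simp
    _ ≤ 9 ^ k * k ! * (Real.exp (-(2 / (9 * x))) * (Real.exp (2 / (9 * x)) * k !)) := by gcongr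
    _ = 9 ^ k * k ! * ((Real.exp (-(2 / (9 * x))) * Real.exp (2 / (9 * x))) * k !) := by ring
    _ = _ := by rw [← Real.exp_add, neg_add_cancel, Real.exp_zero]; ring

theorem isGevreyTwo_expNegInvGlue : IsGevreyTwo 9 expNegInvGlue := by
  refine ⟨expNegInvGlue.contDiff, 1, fun k x => ?_⟩
  rw [one_mul]
  have hcont : Continuous (iteratedDeriv k expNegInvGlue) :=
    expNegInvGlue.contDiff.continuous_iteratedDeriv' k
  have hclosed : IsClosed {x | |iteratedDeriv k expNegInvGlue x| ≤ 9 ^ k * (k ! : ℝ) ^ 2} :=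
    isClosed_le hcont.abs continuous_const
  have hsub : ({0}ᶜ : Set ℝ) ⊆ {x | |iteratedDeriv k expNegInvGlue x| ≤ 9 ^ k * (k ! : ℝ) ^ 2} := by
    intro y hy
    rcases lt_or_gt_of_ne hy with hy | hy
    · have h0 : expNegInvGlue =ᶠ[𝓝 y] fun _ => 0 := by
        filter_upwards [gt_mem_nhds hy] with z hz
        exact expNegInvGlue.zero_of_nonpos hz.le
      rw [mem_ofPred_eq, h0.iteratedDeriv_eq k]
      simp only [iteratedDeriv_const, ite_self, abs_zero]
      positivity
    · exact abs_iteratedDeriv_expNegInvGlue_le_of_pos k hy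
  exact hclosed.closure_subset_iff.2 hsub ((dense_compl_singleton (0 : ℝ)) x)

/-- A smooth step in the Gevrey class with constant `1 / 2`. -/
theorem exists_gevrey_step :
    ∃ G : ℝ → ℝ, IsGevreyTwo (1 / 2) G ∧ (∀ x, G x ∈ Icc (0 : ℝ) 1) ∧
      (∀ x ≤ 0, G x = 0) ∧ ∀ x, 1 ≤ x → G x = 1 := by
  set g : ℝ → ℝ := (fun x => expNegInvGlue (1 / 36 * x + 0)) *
    (fun x => expNegInvGlue (-(1 / 36) * x + 1 / 36)) with hg
  have hgG : IsGevreyTwo (1 / 2) g := by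
    have h1 := isGevreyTwo_expNegInvGlue.comp_affine (1 / 36) 0
    have h2 := isGevreyTwo_expNegInvGlue.comp_affine (-(1 / 36)) (1 / 36)
    rw [abs_neg] at h2
    convert h1.mul (by positivity) h2 using 1
    rw [abs_of_pos (by norm_num)]
    norm_num
  have hcont : Continuous g := hgG.1.continuous
  have hint : ∀ a b, IntervalIntegrable g MeasureTheory.volume a b := hcont.intervalIntegrable
  have hnonneg : ∀ x, 0 ≤ g x := fun x =>
    mul_nonneg (expNegInvGlue.nonneg _) (expNegInvGlue.nonneg _)
  have hpos : 0 < ∫ x in (0 : ℝ)..1, g x :=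
    intervalIntegral.intervalIntegral_pos_of_pos_on (hint 0 1) (fun x hx =>
      mul_pos (expNegInvGlue.pos_of_pos (by linarith [hx.1]))
        (expNegInvGlue.pos_of_pos (by linarith [hx.2]))) one_pos
  set I : ℝ := ∫ x in (0 : ℝ)..1, g x with hI
  have hzero_left : ∀ x ≤ 0, ∫ t in (0 : ℝ)..x, g t = 0 := fun x hx => by
    refine intervalIntegral.integral_zero_ae (.of_forall fun t ht => ?_)
    rw [uIoc_of_ge hx] at ht
    simp [hg, expNegInvGlue.zero_of_nonpos (show 36⁻¹ * t ≤ 0 by linarith [ht.2])]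
  have hzero_right : ∀ x, 1 ≤ x → ∫ t in (0 : ℝ)..x, g t = I := fun x hx => by
    have : ∫ t in (1 : ℝ)..x, g t = 0 := by
      refine intervalIntegral.integral_zero_ae (.of_forall fun t ht => ?_)
      rw [uIoc_of_le hx] at ht
      simp [hg, expNegInvGlue.zero_of_nonpos (show -(36⁻¹ * t) + 36⁻¹ ≤ 0 by linarith [ht.1])]
    rw [← intervalIntegral.integral_add_adjacent_intervals (hint 0 1) (hint 1 x), this, add_zero]
  have hmono : Monotone fun x => ∫ t in (0 : ℝ)..x, g t := fun a b hab => by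
    have := intervalIntegral.integral_nonneg hab (μ := MeasureTheory.volume) fun x _ => hnonneg x
    have := intervalIntegral.integral_add_adjacent_intervals (hint 0 a) (hint a b)
    simp only
    linarith
  have hderiv : ∀ x, HasDerivAt (fun x => I⁻¹ * ∫ t in (0 : ℝ)..x, g t) (I⁻¹ * g x) x := fun x =>
    (hcont.integral_hasStrictDerivAt 0 x).hasDerivAt.const_mul _
  have hmem : ∀ x, I⁻¹ * ∫ t in (0 : ℝ)..x, g t ∈ Icc (0 : ℝ) 1 := fun x => by
    have h0 : 0 ≤ ∫ t in (0 : ℝ)..x, g t :=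
      (hzero_left (min 0 x) (min_le_left _ _)).ge.trans (hmono (min_le_right _ _))
    have h1 : ∫ t in (0 : ℝ)..x, g t ≤ I :=
      (hmono (le_max_right _ _)).trans (hzero_right (max 1 x) (le_max_left _ _)).le
    refine ⟨by positivity, ?_⟩
    rw [inv_mul_le_iff₀ hpos, mul_one]
    exact h1
  refine ⟨fun x => I⁻¹ * ∫ t in (0 : ℝ)..x, g t, ?_, hmem, fun x hx => ?_, fun x hx => ?_⟩
  · refine IsGevreyTwo.of_deriv (by norm_num) (fun x => (hderiv x).differentiableAt) (B := 1)
      (fun x => abs_le.2 ⟨by linarith [(hmem x).1], (hmem x).2⟩) ?_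
    rw [funext fun x => (hderiv x).deriv]
    exact hgG.const_mul _
  · simp only [hzero_left x hx, mul_zero]
  · simp only [hzero_right x hx, inv_mul_cancel₀ hpos.ne']

/-- **Claim (existence of a Gevrey-class cut-off function).**
There is a `C^∞` function `χ : ℝ → [0,1]` which is even, equals `1` on `[-1,1]`,
vanishes off `[-2,2]`, and whose derivatives satisfy `|χ^{(k)}| ≤ C (k!)²`. -/
theorem exists_gevrey_cutoff :
    ∃ χ : ℝ → ℝ, ContDiff ℝ (⊤ : ℕ∞) χ ∧ (∀ t : ℝ, χ t ∈ Set.Icc (0:ℝ) 1) ∧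
      (∀ t : ℝ, χ (-t) = χ t) ∧ (∀ t : ℝ, |t| ≤ 1 → χ t = 1) ∧
      (∀ t : ℝ, 2 ≤ |t| → χ t = 0) ∧
      ∃ C : ℝ, 0 < C ∧ ∀ k : ℕ, 1 ≤ k → ∀ t : ℝ,
        |iteratedDeriv k χ t| ≤ C * ((Nat.factorial k : ℝ)) ^ 2 := by
  obtain ⟨G, hG, hmem, hzero, hone⟩ := exists_gevrey_step
  have h := (hG.comp_affine (-1) 2).mul (by positivity) (by simpa using hG.comp_affine 1 2)
  obtain ⟨hsmooth, C, hC⟩ := h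
  refine ⟨_, hsmooth, fun t => ?_, fun t => ?_, fun t ht => ?_, fun t ht => ?_, max C 1,
    by positivity, fun k _ t => ?_⟩
  · simp only [Pi.mul_apply]
    exact ⟨mul_nonneg (hmem _).1 (hmem _).1, mul_le_one₀ (hmem _).2 (hmem _).1 (hmem _).2⟩
  · simp [mul_comm]
  · obtain ⟨h1, h2⟩ := abs_le.1 ht
    simp only [Pi.mul_apply]
    rw [hone _ (by linarith), hone _ (by linarith), one_mul]
  · simp only [Pi.mul_apply]
    rcases le_abs.1 ht with h | h
    · rw [hzero _ (by linarith), zero_mul]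
    · rw [hzero (t + 2) (by linarith), mul_zero]
  · refine (hC k t).trans ?_
    norm_num
    gcongr
    exact le_max_left _ _
end
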